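/- With the notation of the context, for every integer k ≥ −1 the tau function satisfies the Virasoro constraint 𝔅_k τ^E_{m,n} = 𝕍_k^{m,n} τ^E_{m,n}, where 𝔅_k := Σ_{i=1}^{2r} c_i^{k+1} ∂/∂c_i, as an identity of functions of all the parameters (endpoints c_1,…,c_{2r}, the a's, b's, α's, β's, and the finitely supported time variables). -/

import Mathlib

open MeasureTheory Finset

/-- Partial sum `M_k = Σ_{j<k} m_j` of the block sizes. -/
def Msum {q : ℕ} (m : Fin q → ℕ) (k : ℕ) : ℕ :=
  ∑ j ∈ Finset.univ.filter (fun j : Fin q => (j : ℕ) < k), m j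

theorem Msum_add_lt {q : ℕ} (m : Fin q → ℕ) (r : Fin q) (i : Fin (m r)) :
    Msum m (r : ℕ) + (i : ℕ) < ∑ j, m j := by
  have h2 : m r ≤ ∑ j ∈ Finset.univ.filter (fun j : Fin q => ¬ (j : ℕ) < (r : ℕ)), m j :=
    Finset.single_le_sum (fun j _ => Nat.zero_le (m j)) (by simp)
  have h3 : Msum m (r : ℕ) +
      ∑ j ∈ Finset.univ.filter (fun j : Fin q => ¬ (j : ℕ) < (r : ℕ)), m j = ∑ j, m j :=
    Finset.sum_filter_add_sum_filter_not _ _ _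
  have h4 := i.isLt
  omega

/-- The index `M_{r−1} + i` of the `i`-th element of the `r`-th block (`0`-based). -/
def blkIdx {q : ℕ} (m : Fin q → ℕ) (r : Fin q) (i : Fin (m r)) : Fin (∑ j, m j) :=
  ⟨Msum m (r : ℕ) + (i : ℕ), Msum_add_lt m r i⟩

theorem Msum_block_le {q : ℕ} (m : Fin q → ℕ) {u u' : Fin q} (h : u < u') :
    Msum m (u : ℕ) + m u ≤ Msum m (u' : ℕ) := by
  have hsub : insert u (Finset.univ.filter (fun j : Fin q => (j : ℕ) < (u : ℕ)))
      ⊆ Finset.univ.filter (fun j : Fin q => (j : ℕ) < (u' : ℕ)) := by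
    intro j hj
    simp only [Finset.mem_insert, Finset.mem_filter, Finset.mem_univ, true_and] at hj ⊢
    have huu' : (u : ℕ) < (u' : ℕ) := h
    rcases hj with rfl | hj
    · exact huu'
    · omega
  have hle := Finset.sum_le_sum_of_subset (f := m) hsub
  rw [Finset.sum_insert (by simp)] at hle
  unfold Msum
  omega

theorem blkIdx_injective {q : ℕ} (m : Fin q → ℕ) :
    Function.Injective (fun x : Σ r : Fin q, Fin (m r) => blkIdx m x.1 x.2) := by
  rintro ⟨r, i⟩ ⟨r', i'⟩ h
  have hval : Msum m (r : ℕ) + (i : ℕ) = Msum m (r' : ℕ) + (i' : ℕ) := congrArg Fin.val h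
  rcases lt_trichotomy r r' with hlt | heq | hgt
  · exact absurd hval (by have h1 := Msum_block_le m hlt; have h2 := i.isLt; omega)
  · subst heq
    have : i = i' := Fin.ext (by omega)
    rw [this]
  · exact absurd hval (by have h1 := Msum_block_le m hgt; have h2 := i'.isLt; omega)

/-- The canonical (order-preserving) equivalence between `Σ r, Fin (m r)` and `Fin (Σ m)`,
sending `(r, i)` to `M_{r−1} + i`. -/
noncomputable def blkEquiv {q : ℕ} (m : Fin q → ℕ) : (Σ r : Fin q, Fin (m r)) ≃ Fin (∑ j, m j) :=
  Equiv.ofBijective (fun x => blkIdx m x.1 x.2)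
    ((Fintype.bijective_iff_injective_and_card _).mpr
      ⟨blkIdx_injective m, by simp [Fintype.card_sigma]⟩)

/-- The deformed tau function `τ^E_{m,n}(t,s;α,β;a,b)`: the determinant of the `N×N` moment
matrix composed of `p·q` blocks, the `(k,l)` block of size `m_k × n_l` having entries
`∫_E x^{i+j} exp((a_k+b_l)x + (α_k+β_l)x² − Σ_{ν≥1} s_ν^{(k)} x^ν + Σ_{ν≥1} t_ν^{(l)} x^ν − x²/2) dx`
(defined to be `0` when the total block sizes do not match). -/
noncomputable def tauGen {q p : ℕ} (m : Fin q → ℕ) (n : Fin p → ℕ) (E : Set ℝ)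
    (a : Fin q → ℝ) (b : Fin p → ℝ) (al : Fin q → ℝ) (be : Fin p → ℝ)
    (s : Fin q → ℕ → ℝ) (t : Fin p → ℕ → ℝ) : ℝ :=
  if h : ∑ l, n l = ∑ k, m k then
    Matrix.det (Matrix.of fun ri cj : Fin (∑ k, m k) =>
      ∫ x in E,
        x ^ (((((blkEquiv m).symm ri).2 : ℕ)) + ((((blkEquiv n).symm (finCongr h.symm cj)).2 : ℕ))) *
          Real.exp ((a ((blkEquiv m).symm ri).1 + b ((blkEquiv n).symm (finCongr h.symm cj)).1) * x
            + (al ((blkEquiv m).symm ri).1 + be ((blkEquiv n).symm (finCongr h.symm cj)).1) * x ^ 2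
            - (∑ᶠ ν ∈ Set.Ici (1 : ℕ), s ((blkEquiv m).symm ri).1 ν * x ^ ν)
            + (∑ᶠ ν ∈ Set.Ici (1 : ℕ), t ((blkEquiv n).symm (finCongr h.symm cj)).1 ν * x ^ ν)
            - x ^ 2 / 2))
  else 0

/-- The set `E = ⋃_{i=1}^r [c_{2i−1}, c_{2i}]`. -/
def Eset {r : ℕ} (c : Fin (2 * r) → ℝ) : Set ℝ :=
  ⋃ i : Fin r, Set.Icc (c ⟨2 * (i : ℕ), by have := i.isLt; omega⟩)
    (c ⟨2 * (i : ℕ) + 1, by have := i.isLt; omega⟩)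

/-- The full set of parameters of the deformed problem: the starting/ending points `a, b`,
the auxiliary parameters `α, β`, the time variables `s, t`, and the endpoints `c` of `E`. -/
structure Par (q p r : ℕ) where
  a : Fin q → ℝ
  b : Fin p → ℝ
  al : Fin q → ℝ
  be : Fin p → ℝ
  s : Fin q → ℕ → ℝ
  t : Fin p → ℕ → ℝ
  c : Fin (2 * r) → ℝ

/-- `∂/∂a_k`. -/
noncomputable def dAp {q p r : ℕ} (k : Fin q) (f : Par q p r → ℝ) : Par q p r → ℝ :=
  fun P => deriv (fun h => f { P with a := Function.update P.a k h }) (P.a k)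

/-- `∂/∂b_l`. -/
noncomputable def dBp {q p r : ℕ} (l : Fin p) (f : Par q p r → ℝ) : Par q p r → ℝ :=
  fun P => deriv (fun h => f { P with b := Function.update P.b l h }) (P.b l)

/-- `∂/∂α_k`. -/
noncomputable def dAlp {q p r : ℕ} (k : Fin q) (f : Par q p r → ℝ) : Par q p r → ℝ :=
  fun P => deriv (fun h => f { P with al := Function.update P.al k h }) (P.al k)

/-- `∂/∂β_l`. -/
noncomputable def dBep {q p r : ℕ} (l : Fin p) (f : Par q p r → ℝ) : Par q p r → ℝ :=
  fun P => deriv (fun h => f { P with be := Function.update P.be l h }) (P.be l)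

/-- `∂/∂s_ν^{(k)}`. -/
noncomputable def dSp {q p r : ℕ} (k : Fin q) (ν : ℕ) (f : Par q p r → ℝ) : Par q p r → ℝ :=
  fun P => deriv
    (fun h => f { P with s := Function.update P.s k (Function.update (P.s k) ν h) }) (P.s k ν)

/-- `∂/∂t_ν^{(l)}`. -/
noncomputable def dTp {q p r : ℕ} (l : Fin p) (ν : ℕ) (f : Par q p r → ℝ) : Par q p r → ℝ :=
  fun P => deriv
    (fun h => f { P with t := Function.update P.t l (Function.update (P.t l) ν h) }) (P.t l ν)

/-- `∂/∂c_i`. -/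
noncomputable def dCp {q p r : ℕ} (i : Fin (2 * r)) (f : Par q p r → ℝ) : Par q p r → ℝ :=
  fun P => deriv (fun h => f { P with c := Function.update P.c i h }) (P.c i)

/-- The tau function `τ^E_{m,n}` as a function of all the parameters, with
`E = ⋃_{i=1}^r [c_{2i−1}, c_{2i}]`. -/
noncomputable def tauPar {q p r : ℕ} (m : Fin q → ℕ) (n : Fin p → ℕ) : Par q p r → ℝ :=
  fun P => tauGen m n (Eset P.c) P.a P.b P.al P.be P.s P.t

/-- `𝕁^{(1)}_{m,n}(−s^{(k)})` acting on functions of all the parameters. -/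
noncomputable def J1Sp {q p r : ℕ} (k : Fin q) (mm : ℤ) (nn : ℝ) (f : Par q p r → ℝ) :
    Par q p r → ℝ :=
  fun P =>
    -(if 0 < mm then dSp k mm.toNat f P else 0)
    + (-(mm : ℝ)) * (-(if 0 < -mm then P.s k (-mm).toNat else 0)) * f P
    + (if mm = 0 then nn else 0) * f P

/-- `𝕁^{(2)}_{m,n}(−s^{(k)})` acting on functions of all the parameters. -/
noncomputable def J2Sp {q p r : ℕ} (k : Fin q) (mm : ℤ) (nn : ℝ) (f : Par q p r → ℝ) :
    Par q p r → ℝ :=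
  fun P =>
    (1 / 2 : ℝ) * ((∑ i ∈ Finset.Icc (1 : ℤ) (mm - 1), dSp k i.toNat (dSp k (mm - i).toNat f) P)
        + 2 * (∑ᶠ i ∈ Set.Ici (1 : ℕ), (i : ℝ) * P.s k i *
            (if 0 < (i : ℤ) + mm then dSp k ((i : ℤ) + mm).toNat f P else 0))
        + (∑ i ∈ Finset.Icc (1 : ℤ) (-mm - 1), (i : ℝ) * ((-mm - i : ℤ) : ℝ) *
            P.s k i.toNat * P.s k (-mm - i).toNat) * f P)
    + (nn + ((mm : ℝ) + 1) / 2) *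
        (-(if 0 < mm then dSp k mm.toNat f P else 0)
          + (mm : ℝ) * (if 0 < -mm then P.s k (-mm).toNat else 0) * f P)
    + (if mm = 0 then nn * (nn + 1) / 2 else 0) * f P

/-- `𝕁^{(1)}_{m,n}(t^{(l)})` acting on functions of all the parameters. -/
noncomputable def J1Tp {q p r : ℕ} (l : Fin p) (mm : ℤ) (nn : ℝ) (f : Par q p r → ℝ) :
    Par q p r → ℝ :=
  fun P =>
    (if 0 < mm then dTp l mm.toNat f P else 0)
    + (-(mm : ℝ)) * (if 0 < -mm then P.t l (-mm).toNat else 0) * f P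
    + (if mm = 0 then nn else 0) * f P

/-- `𝕁^{(2)}_{m,n}(t^{(l)})` acting on functions of all the parameters. -/
noncomputable def J2Tp {q p r : ℕ} (l : Fin p) (mm : ℤ) (nn : ℝ) (f : Par q p r → ℝ) :
    Par q p r → ℝ :=
  fun P =>
    (1 / 2 : ℝ) * ((∑ i ∈ Finset.Icc (1 : ℤ) (mm - 1), dTp l i.toNat (dTp l (mm - i).toNat f) P)
        + 2 * (∑ᶠ i ∈ Set.Ici (1 : ℕ), (i : ℝ) * P.t l i *
            (if 0 < (i : ℤ) + mm then dTp l ((i : ℤ) + mm).toNat f P else 0))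
        + (∑ i ∈ Finset.Icc (1 : ℤ) (-mm - 1), (i : ℝ) * ((-mm - i : ℤ) : ℝ) *
            P.t l i.toNat * P.t l (-mm - i).toNat) * f P)
    + (nn + ((mm : ℝ) + 1) / 2) *
        ((if 0 < mm then dTp l mm.toNat f P else 0)
          + (-(mm : ℝ)) * (if 0 < -mm then P.t l (-mm).toNat else 0) * f P)
    + (if mm = 0 then nn * (nn + 1) / 2 else 0) * f P

/-- The Virasoro-type operator `𝕍_k^{m,n}` acting on functions of all the parameters. -/
noncomputable def Vpar {q p r : ℕ} (m : Fin q → ℕ) (n : Fin p → ℕ) (k : ℤ)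
    (f : Par q p r → ℝ) : Par q p r → ℝ :=
  fun P =>
    (∑ i : Fin q, (J2Sp i k ((m i : ℕ) : ℝ) f P + P.a i * J1Sp i (k + 1) ((m i : ℕ) : ℝ) f P
        - (1 - 2 * P.al i) * J1Sp i (k + 2) ((m i : ℕ) : ℝ) f P))
    + ∑ i : Fin p, (J2Tp i k ((n i : ℕ) : ℝ) f P + P.b i * J1Tp i (k + 1) ((n i : ℕ) : ℝ) f P
        + 2 * P.be i * J1Tp i (k + 2) ((n i : ℕ) : ℝ) f P
        - ((k : ℝ) + 1) * J1Tp i k ((n i : ℕ) : ℝ) f P)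

/-- Raise the exponent attached to `r` by `h`. -/
def raiseExp {ι : Type*} [DecidableEq ι] (e : ι → ℕ) (r : ι) (h : ℕ) : ι → ℕ :=
  Function.update e r (e r + h)

/-- Antidiagonal sums of an antisymmetric function telescope to a boundary term. -/
theorem sum_antisymm_eq_neg (G : ℕ → ℕ → ℝ) (hG : ∀ A B, G A B = -G B A) {i i' k : ℕ}
    (hi : i < i') (hk : 1 ≤ k) (h0 : ∀ A B, i < A → A < i' → G A B = 0) :
    ∑ h ∈ Icc 1 (k - 1), G (i + h) (i' + (k - h)) = -G (i + k) i' := by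
  rcases le_or_gt k (i' - i) with hle | hlt
  · rw [Finset.sum_eq_zero]
    · rcases eq_or_lt_of_le (show i + k ≤ i' by omega) with h | h
      · have := hG i' i'
        rw [h]; linarith
      · rw [h0 _ _ (by omega) h, neg_zero]
    · intro h hh
      rw [Finset.mem_Icc] at hh
      exact h0 _ _ (by omega) (by omega)
  · obtain ⟨d, rfl⟩ : ∃ d, i' = i + d := ⟨i' - i, by omega⟩
    have hsplit : Icc 1 (k - 1) = Ico 1 d ∪ ({d} ∪ Icc (d + 1) (k - 1)) := by
      ext x
      simp only [Finset.mem_Icc, Finset.mem_union, Finset.mem_Ico, Finset.mem_singleton]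
      omega
    rw [hsplit, Finset.sum_union, Finset.sum_union, Finset.sum_singleton]
    · have h1 : ∑ h ∈ Ico 1 d, G (i + h) (i + d + (k - h)) = 0 := by
        refine Finset.sum_eq_zero fun h hh => ?_
        rw [Finset.mem_Ico] at hh
        exact h0 _ _ (by omega) (by omega)
      have h2 : ∑ h ∈ Icc (d + 1) (k - 1), G (i + h) (i + d + (k - h))
          = -∑ h ∈ Icc (d + 1) (k - 1), G (i + h) (i + d + (k - h)) := by
        rw [← Finset.sum_neg_distrib]
        refine Finset.sum_nbij' (fun h => d + k - h) (fun h => d + k - h) ?_ ?_ ?_ ?_ ?_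
        · intro h hh; rw [Finset.mem_Icc] at *; omega
        · intro h hh; rw [Finset.mem_Icc] at *; omega
        · intro h hh; rw [Finset.mem_Icc] at *; omega
        · intro h hh; rw [Finset.mem_Icc] at *; omega
        · intro h hh
          rw [Finset.mem_Icc] at hh
          rw [hG]
          congr 2 <;> omega
      have h3 : G (i + d) (i + d + (k - d)) = -G (i + k) (i + d) := by
        rw [hG]; congr 2; omega
      rw [h1, h3]; linarith
    · rw [Finset.disjoint_left]
      intro x; simp only [Finset.mem_Icc, Finset.mem_singleton]; omega
    · rw [Finset.disjoint_left]
      intro x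
      simp only [Finset.mem_Icc, Finset.mem_singleton, Finset.mem_union, Finset.mem_Ico]; omega

section Alternating

variable {q : ℕ} {m : Fin q → ℕ} {V : Type*}

/-- The family of vectors `v κ (e (κ, i))` attached to the exponents `e`. -/
def blockRows (v : Fin q → ℕ → V) (e : (Σ κ : Fin q, Fin (m κ)) → ℕ) :
    (Σ κ : Fin q, Fin (m κ)) → V :=
  fun r => v r.1 (e r)

theorem update_blockRows (v : Fin q → ℕ → V) (e : (Σ κ : Fin q, Fin (m κ)) → ℕ)
    (r : Σ κ : Fin q, Fin (m κ)) (A : ℕ) :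
    Function.update (blockRows v e) r (v r.1 A) = blockRows v (Function.update e r A) := by
  ext r'
  by_cases h : r' = r
  · subst h; simp [blockRows]
  · simp [blockRows, h]

variable [AddCommGroup V] [Module ℝ V]

theorem sum_map_blockRows_raise_pair
    (F : V [⋀^(Σ κ : Fin q, Fin (m κ))]→ₗ[ℝ] ℝ) (v : Fin q → ℕ → V) (κ : Fin q)
    (i i' : Fin (m κ)) (hi : i < i') {k : ℕ} (hk : 1 ≤ k) :
    ∑ h ∈ Icc 1 (k - 1), F (blockRows v
        (raiseExp (raiseExp (fun r => (r.2 : ℕ)) ⟨κ, i⟩ h) ⟨κ, i'⟩ (k - h)))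
      = -F (blockRows v (raiseExp (fun r => (r.2 : ℕ)) ⟨κ, i⟩ k)) := by
  have hne : (⟨κ, i'⟩ : Σ κ : Fin q, Fin (m κ)) ≠ ⟨κ, i⟩ := by
    intro h
    simp only [Sigma.mk.injEq, heq_eq_eq, true_and] at h
    exact hi.ne' h
  have key := sum_antisymm_eq_neg (fun A B => F (blockRows v
    (Function.update (Function.update (fun r => (r.2 : ℕ)) ⟨κ, i⟩ A) ⟨κ, i'⟩ B))) ?_
    (i := i) (i' := i') hi hk ?_
  · convert key using 3 with h hh
    · congr 1
      simp [raiseExp, hne]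
    · congr 1
      rw [raiseExp, eq_comm, Function.update_eq_self_iff]
      simp [hne]
  · intro A B
    rw [← F.map_swap _ hne]
    congr 1
    ext r
    by_cases h1 : r = ⟨κ, i⟩
    · subst h1; simp [blockRows, hne.symm]
    · by_cases h2 : r = ⟨κ, i'⟩
      · subst h2; simp [blockRows, hne.symm]
      · simp [blockRows, h1, h2, Equiv.swap_apply_of_ne_of_ne h2 h1]
  · intro A B h1 h2
    have hA : A < m κ := h2.trans i'.isLt
    have e1 : (⟨κ, ⟨A, hA⟩⟩ : Σ κ : Fin q, Fin (m κ)) ≠ ⟨κ, i⟩ := by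
      intro h; simp [Fin.ext_iff] at h; omega
    have e2 : (⟨κ, ⟨A, hA⟩⟩ : Σ κ : Fin q, Fin (m κ)) ≠ ⟨κ, i'⟩ := by
      intro h; simp [Fin.ext_iff] at h; omega
    refine F.map_eq_zero_of_eq _ (i := ⟨κ, i⟩) (j := ⟨κ, ⟨A, hA⟩⟩) ?_ e1.symm
    simp [blockRows, e1, e2, hne.symm]

/-- The quadratic Virasoro identity for an alternating map: the sum over a block of the double
raising operators is expressed through single raising operators. -/
theorem half_sum_double_raise
    (F : V [⋀^(Σ κ : Fin q, Fin (m κ))]→ₗ[ℝ] ℝ) (v : Fin q → ℕ → V) (κ : Fin q)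
    {k : ℕ} (hk : 1 ≤ k) :
    (1 / 2 : ℝ) * (∑ h ∈ Icc 1 (k - 1), ∑ i : Fin (m κ), ∑ i' : Fin (m κ), F (blockRows v
        (raiseExp (raiseExp (fun r => (r.2 : ℕ)) ⟨κ, i⟩ h) ⟨κ, i'⟩ (k - h))))
      + ((m κ : ℝ) - ((k : ℝ) + 1) / 2) *
        ∑ i : Fin (m κ), F (blockRows v (raiseExp (fun r => (r.2 : ℕ)) ⟨κ, i⟩ k))
      = ∑ i : Fin (m κ), (i : ℝ) *
        F (blockRows v (raiseExp (fun r => (r.2 : ℕ)) ⟨κ, i⟩ k)) := by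
  set X : Fin (m κ) → ℝ := fun i =>
    F (blockRows v (raiseExp (fun r => (r.2 : ℕ)) ⟨κ, i⟩ k)) with hX
  set T : Fin (m κ) → Fin (m κ) → ℝ := fun i i' => ∑ h ∈ Icc 1 (k - 1), F (blockRows v
        (raiseExp (raiseExp (fun r => (r.2 : ℕ)) ⟨κ, i⟩ h) ⟨κ, i'⟩ (k - h))) with hT
  have hlt : ∀ i i', i < i' → T i i' = -X i := fun i i' h =>
    sum_map_blockRows_raise_pair F v κ i i' h hk
  have hsymm : ∀ i i', i ≠ i' → T i i' = T i' i := by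
    intro i i' hii
    have hne : (⟨κ, i'⟩ : Σ κ : Fin q, Fin (m κ)) ≠ ⟨κ, i⟩ := by
      intro h
      simp only [Sigma.mk.injEq, heq_eq_eq, true_and] at h
      exact hii h.symm
    refine Finset.sum_nbij' (fun h => k - h) (fun h => k - h) ?_ ?_ ?_ ?_ ?_
    · intro h hh; rw [Finset.mem_Icc] at *; omega
    · intro h hh; rw [Finset.mem_Icc] at *; omega
    · intro h hh; rw [Finset.mem_Icc] at *; omega
    · intro h hh; rw [Finset.mem_Icc] at *; omega
    · intro h hh
      rw [Finset.mem_Icc] at hh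
      rw [show k - (k - h) = h by omega]
      congr 2
      simp only [raiseExp, Function.update_of_ne hne, Function.update_of_ne hne.symm]
      exact Function.update_comm hne.symm _ _ _
  have hdiag : ∀ i, T i i = ((k : ℝ) - 1) * X i := by
    intro i
    have : ∀ h ∈ Icc 1 (k - 1), F (blockRows v
        (raiseExp (raiseExp (fun r => (r.2 : ℕ)) ⟨κ, i⟩ h) ⟨κ, i⟩ (k - h))) = X i := by
      intro h hh
      rw [Finset.mem_Icc] at hh
      simp only [raiseExp, hX, Function.update_self, Function.update_idem]
      rw [show (i : ℕ) + h + (k - h) = i + k by omega]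
    simp only [hT]
    rw [Finset.sum_congr rfl this, Finset.sum_const, Nat.card_Icc, nsmul_eq_mul,
      Nat.add_sub_cancel, Nat.cast_sub hk, Nat.cast_one]
  have hTeq : ∀ i i', T i i' = -(if i < i' then X i else 0) - (if i' < i then X i' else 0)
      + (if i = i' then ((k : ℝ) - 1) * X i else 0) := by
    intro i i'
    rcases lt_trichotomy i i' with h | h | h
    · simp [h, h.ne, h.not_gt, hlt i i' h]
    · subst h; simp [hdiag]
    · simp [h, h.ne', h.not_gt, hsymm i i' h.ne', hlt i' i h]
  have hcount : ∀ i : Fin (m κ), ∑ i', (if i < i' then X i else 0)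
      = ((m κ : ℝ) - 1 - i) * X i := by
    intro i
    rw [← Finset.sum_filter, Finset.sum_const, nsmul_eq_mul]
    congr 1
    have hcard : (Finset.univ.filter (fun i' => i < i')).card = m κ - 1 - i := by
      rw [← Fin.card_Ioi i]
      congr 1
      ext; simp
    have := i.isLt
    rw [hcard, Nat.sub_sub, Nat.cast_sub (by omega)]
    push_cast
    ring
  have hsum : ∑ i, ∑ i', T i i' = ∑ i, (-2 * ((m κ : ℝ) - 1 - i) + (k - 1)) * X i := by
    simp only [hTeq, Finset.sum_add_distrib, Finset.sum_sub_distrib, Finset.sum_neg_distrib,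
      add_mul]
    rw [Finset.sum_comm (f := fun i i' => if i' < i then X i' else 0)]
    simp only [hcount, Finset.sum_ite_eq, Finset.mem_univ, if_true]
    rw [← Finset.sum_neg_distrib, ← Finset.sum_sub_distrib]
    congr 1
    exact Finset.sum_congr rfl fun i _ => by ring
  have hswap : (∑ h ∈ Icc 1 (k - 1), ∑ i : Fin (m κ), ∑ i' : Fin (m κ), F (blockRows v
        (raiseExp (raiseExp (fun r => (r.2 : ℕ)) ⟨κ, i⟩ h) ⟨κ, i'⟩ (k - h))))
      = ∑ i, ∑ i', T i i' := by
    rw [Finset.sum_comm]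
    refine Finset.sum_congr rfl fun i _ => ?_
    rw [Finset.sum_comm]
  rw [hswap, hsum, Finset.mul_sum, Finset.mul_sum, ← Finset.sum_add_distrib]
  exact Finset.sum_congr rfl fun i _ => by ring

end Alternating

section Raising

variable {q : ℕ} {m : Fin q → ℕ} {V : Type*} [AddCommGroup V] [Module ℝ V]

/-- Sum over the block `κ` of the values of `F` with one exponent raised by `h`. -/
noncomputable def raiseSum (F : V [⋀^(Σ κ : Fin q, Fin (m κ))]→ₗ[ℝ] ℝ) (v : Fin q → ℕ → V)
    (κ : Fin q) (h : ℕ) : ℝ :=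
  ∑ i : Fin (m κ), F (blockRows v (raiseExp (fun r => (r.2 : ℕ)) ⟨κ, i⟩ h))

/-- Sum over the block `κ` of the values of `F` with exponents raised by `h'`, then by `h`. -/
noncomputable def raiseSum₂ (F : V [⋀^(Σ κ : Fin q, Fin (m κ))]→ₗ[ℝ] ℝ) (v : Fin q → ℕ → V)
    (κ : Fin q) (h h' : ℕ) : ℝ :=
  ∑ i : Fin (m κ), ∑ i' : Fin (m κ), F (blockRows v
    (raiseExp (raiseExp (fun r => (r.2 : ℕ)) ⟨κ, i⟩ h') ⟨κ, i'⟩ h))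

/-- The action on the block `κ` of the vector field `x ^ K * d/dx`, twisted by `θ`. -/
noncomputable def wittSum (F : V [⋀^(Σ κ : Fin q, Fin (m κ))]→ₗ[ℝ] ℝ) (v : Fin q → ℕ → V)
    (κ : Fin q) (θ : ℝ) (K : ℕ) : ℝ :=
  ∑ i : Fin (m κ), ((i : ℝ) + θ) *
    F (blockRows v (Function.update (fun r => (r.2 : ℕ)) ⟨κ, i⟩ (i + K - 1)))

variable (F : V [⋀^(Σ κ : Fin q, Fin (m κ))]→ₗ[ℝ] ℝ) (v : Fin q → ℕ → V) (κ : Fin q)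

theorem raiseSum_zero : raiseSum F v κ 0 = m κ * F (blockRows v fun r => (r.2 : ℕ)) := by
  simp [raiseSum, raiseExp]

theorem wittSum_succ (θ : ℝ) (k : ℕ) :
    wittSum F v κ θ (k + 1) = wittSum F v κ 0 (k + 1) + θ * raiseSum F v κ k := by
  simp only [wittSum, raiseSum, raiseExp, Finset.mul_sum, ← Finset.sum_add_distrib]
  refine Finset.sum_congr rfl fun i _ => ?_
  rw [show (i : ℕ) + (k + 1) - 1 = i + k by omega]
  ring

theorem wittSum_zero_zero : wittSum F v κ 0 0 = 0 := by
  refine Finset.sum_eq_zero fun i _ => ?_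
  rcases Nat.eq_zero_or_pos i with h | h
  · simp [h]
  · have hi : (i : ℕ) - 1 < m κ := by omega
    have hne : (⟨κ, ⟨i - 1, hi⟩⟩ : Σ κ : Fin q, Fin (m κ)) ≠ ⟨κ, i⟩ := by
      intro h'; simp [Fin.ext_iff] at h'; omega
    rw [F.map_eq_zero_of_eq _ (i := ⟨κ, i⟩) (j := ⟨κ, ⟨i - 1, hi⟩⟩) _ hne.symm, mul_zero]
    simp [blockRows, hne]

theorem wittSum_zero_one :
    wittSum F v κ 0 1 = (m κ : ℝ) * (m κ - 1) / 2 * F (blockRows v fun r => (r.2 : ℕ)) := by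
  have hsum : ∀ N : ℕ, ∑ i : Fin N, (i : ℝ) = (N : ℝ) * (N - 1) / 2 := by
    intro N
    induction N with
    | zero => simp
    | succ N ih =>
      rw [Fin.sum_univ_castSucc]
      simp only [Fin.val_castSucc, Fin.val_last, ih]
      push_cast; ring
  simp only [wittSum, Nat.add_sub_cancel, add_zero, Function.update_eq_self]
  rw [← Finset.sum_mul, hsum]

theorem wittSum_zero_succ {k : ℕ} (hk : 1 ≤ k) :
    wittSum F v κ 0 (k + 1) = (1 / 2 : ℝ) * (∑ h ∈ Icc 1 (k - 1), raiseSum₂ F v κ h (k - h))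
      + ((m κ : ℝ) - ((k : ℝ) + 1) / 2) * raiseSum F v κ k := by
  have hrefl : ∑ h ∈ Icc 1 (k - 1), raiseSum₂ F v κ h (k - h)
      = ∑ h ∈ Icc 1 (k - 1), raiseSum₂ F v κ (k - h) h := by
    refine Finset.sum_nbij' (fun h => k - h) (fun h => k - h) ?_ ?_ ?_ ?_ ?_
    · intro h hh; rw [Finset.mem_Icc] at *; omega
    · intro h hh; rw [Finset.mem_Icc] at *; omega
    · intro h hh; rw [Finset.mem_Icc] at *; omega
    · intro h hh; rw [Finset.mem_Icc] at *; omega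
    · intro h hh
      rw [Finset.mem_Icc] at hh
      rw [show k - (k - h) = h by omega]
  have key := half_sum_double_raise F v κ hk
  rw [hrefl]
  simp only [raiseSum₂, raiseSum]
  rw [key]
  refine Finset.sum_congr rfl fun i _ => ?_
  rw [show (i : ℕ) + (k + 1) - 1 = i + k by omega, add_zero, raiseExp]

/-- The second-order Virasoro current acting on an alternating map through raising operators. -/
theorem virasoro_current_eq (u : ℕ → ℝ) (S : Finset ℕ) (hS : ∀ ν, ν ∈ S ↔ 1 ≤ ν ∧ u ν ≠ 0)
    (k : ℤ) (K : ℕ) (hK : k = (K : ℤ) - 1) :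
    (1 / 2 : ℝ) * ((∑ i ∈ Finset.Icc (1 : ℤ) (k - 1), raiseSum₂ F v κ i.toNat (k - i).toNat)
        + 2 * (∑ᶠ i ∈ Set.Ici (1 : ℕ), (i : ℝ) * u i *
            (if 0 < (i : ℤ) + k then raiseSum F v κ ((i : ℤ) + k).toNat else 0))
        + (∑ i ∈ Finset.Icc (1 : ℤ) (-k - 1), (i : ℝ) * ((-k - i : ℤ) : ℝ) *
            u i.toNat * u (-k - i).toNat) * F (blockRows v fun r => (r.2 : ℕ)))
    + ((m κ : ℝ) + ((k : ℝ) + 1) / 2) *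
        ((if 0 < k then raiseSum F v κ k.toNat else 0)
          + (-(k : ℝ)) * (if 0 < -k then u (-k).toNat else 0)
            * F (blockRows v fun r => (r.2 : ℕ)))
    + (if k = 0 then (m κ : ℝ) * (m κ + 1) / 2 else 0) * F (blockRows v fun r => (r.2 : ℕ))
    = wittSum F v κ K K + ∑ ν ∈ S, (ν : ℝ) * u ν * raiseSum F v κ (K + ν - 1) := by
  have hfin : (∑ᶠ i ∈ Set.Ici (1 : ℕ), (i : ℝ) * u i *
      (if 0 < (i : ℤ) + k then raiseSum F v κ ((i : ℤ) + k).toNat else 0))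
      = ∑ i ∈ S, (i : ℝ) * u i *
      (if 0 < (i : ℤ) + k then raiseSum F v κ ((i : ℤ) + k).toNat else 0) := by
    apply finsum_mem_eq_sum_of_inter_support_eq
    ext ν
    simp only [Set.mem_inter_iff, Set.mem_Ici, Function.mem_support, Finset.mem_coe, hS]
    constructor
    · rintro ⟨h1, h2⟩
      exact ⟨⟨h1, fun h => h2 (by simp [h])⟩, h2⟩
    · rintro ⟨⟨h1, -⟩, h2⟩
      exact ⟨h1, h2⟩
  rw [hfin]
  obtain _ | _ | K := K
  · obtain rfl : k = -1 := by simpa using hK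
    have hsum : ∑ i ∈ S, (i : ℝ) * u i *
        (if 0 < (i : ℤ) + -1 then raiseSum F v κ ((i : ℤ) + -1).toNat else 0)
        = ∑ ν ∈ S, (ν : ℝ) * u ν * raiseSum F v κ (0 + ν - 1)
          - u 1 * (m κ * F (blockRows v fun r => (r.2 : ℕ))) := by
      have h1 : ∑ ν ∈ S, (if ν = 1 then u 1 * (m κ * F (blockRows v fun r => (r.2 : ℕ))) else 0)
          = u 1 * (m κ * F (blockRows v fun r => (r.2 : ℕ))) := by
        rw [Finset.sum_ite_eq' S 1]
        by_cases h : u 1 = 0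
        · simp [h]
        · rw [if_pos ((hS 1).2 ⟨le_rfl, h⟩)]
      rw [← h1, ← Finset.sum_sub_distrib]
      refine Finset.sum_congr rfl fun ν hν => ?_
      have hν1 := ((hS ν).1 hν).1
      by_cases h : ν = 1
      · subst h; simp [raiseSum_zero]
      · rw [if_pos (by omega), if_neg h, show ((ν : ℤ) + -1).toNat = 0 + ν - 1 by omega, sub_zero]
    rw [hsum, Nat.cast_zero, wittSum_zero_zero]
    simp
    ring
  · obtain rfl : k = 0 := by simpa using hK
    have hsum : ∑ i ∈ S, (i : ℝ) * u i *
        (if 0 < (i : ℤ) + 0 then raiseSum F v κ ((i : ℤ) + 0).toNat else 0)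
        = ∑ ν ∈ S, (ν : ℝ) * u ν * raiseSum F v κ (0 + 1 + ν - 1) := by
      refine Finset.sum_congr rfl fun ν hν => ?_
      have hν1 := ((hS ν).1 hν).1
      rw [if_pos (by omega), show ((ν : ℤ) + 0).toNat = 0 + 1 + ν - 1 by omega]
    rw [hsum, wittSum_succ, wittSum_zero_one, raiseSum_zero]
    simp
    ring
  · obtain rfl : k = (K + 1 : ℕ) := by push_cast at hK ⊢; omega
    have hsum : ∑ i ∈ S, (i : ℝ) * u i *
        (if 0 < (i : ℤ) + (K + 1 : ℕ) then raiseSum F v κ ((i : ℤ) + (K + 1 : ℕ)).toNat else 0)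
        = ∑ ν ∈ S, (ν : ℝ) * u ν * raiseSum F v κ (K + 1 + 1 + ν - 1) := by
      refine Finset.sum_congr rfl fun ν hν => ?_
      rw [if_pos (by omega),
        show ((ν : ℤ) + (K + 1 : ℕ)).toNat = K + 1 + 1 + ν - 1 by omega]
    have hdbl : ∑ i ∈ Finset.Icc (1 : ℤ) ((K + 1 : ℕ) - 1),
        raiseSum₂ F v κ i.toNat (((K + 1 : ℕ) : ℤ) - i).toNat
        = ∑ h ∈ Icc 1 (K + 1 - 1), raiseSum₂ F v κ h (K + 1 - h) := by
      refine Finset.sum_nbij' Int.toNat (fun h : ℕ => (h : ℤ)) ?_ ?_ ?_ ?_ ?_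
      · intro h hh; simp only [Finset.mem_Icc] at *; omega
      · intro h hh; simp only [Finset.mem_Icc] at *; omega
      · intro h hh; simp only [Finset.mem_Icc] at *; omega
      · intro h hh; simp only [Finset.mem_Icc] at *; omega
      · intro h hh
        simp only [Finset.mem_Icc] at hh
        congr 1
        omega
    have hemp : Finset.Icc (1 : ℤ) (-((K + 1 : ℕ) : ℤ) - 1) = ∅ := by
      rw [Finset.Icc_eq_empty]; omega
    rw [hsum, hdbl, wittSum_succ, wittSum_zero_succ F v κ (Nat.succ_le_succ (Nat.zero_le K)), hemp,
      if_pos (by omega), if_neg (by omega), if_neg (by omega), Int.toNat_natCast]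
    push_cast
    simp only [Finset.sum_empty]
    ring

/-- A vector field acting on all the vectors of a block family decomposes into raising operators. -/
theorem sum_map_update_blockRows (θ : ℝ) (A B : Fin q → ℝ) (u : Fin q → ℕ → ℝ)
    (S : Fin q → Finset ℕ) (K : ℕ) :
    ∑ r : (Σ κ : Fin q, Fin (m κ)), F (Function.update (blockRows v fun r => (r.2 : ℕ)) r
        (((r.2 : ℝ) + θ) • v r.1 (r.2 + K - 1) + A r.1 • v r.1 (r.2 + K)
          + B r.1 • v r.1 (r.2 + (K + 1))
          + ∑ ν ∈ S r.1, ((ν : ℝ) * u r.1 ν) • v r.1 (r.2 + (K + ν - 1))))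
      = ∑ κ, (wittSum F v κ θ K + A κ * raiseSum F v κ K + B κ * raiseSum F v κ (K + 1)
          + ∑ ν ∈ S κ, (ν : ℝ) * u κ ν * raiseSum F v κ (K + ν - 1)) := by
  rw [Fintype.sum_sigma]
  refine Finset.sum_congr rfl fun κ _ => ?_
  simp only [AlternatingMap.map_update_add, AlternatingMap.map_update_smul,
    AlternatingMap.map_update_sum, smul_eq_mul, Finset.sum_add_distrib, wittSum, raiseSum,
    Finset.mul_sum, raiseExp]
  rw [Finset.sum_comm (s := S κ)]
  congr 1
  · congr 1
    · congr 1
      · refine Finset.sum_congr rfl fun i _ => ?_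
        rw [← update_blockRows]
      · refine Finset.sum_congr rfl fun i _ => ?_
        rw [← update_blockRows]
    · refine Finset.sum_congr rfl fun i _ => ?_
      rw [← update_blockRows]
  · refine Finset.sum_congr rfl fun i _ => Finset.sum_congr rfl fun ν _ => ?_
    rw [← update_blockRows]

end Raising

/-- Derivative of a determinant, row by row. -/
theorem hasDerivAt_detRowAlternating {ι : Type*} [Fintype ι] [DecidableEq ι]
    {M : ℝ → ι → ι → ℝ} {M' : ι → ι → ℝ} {x : ℝ}
    (h : ∀ r r', HasDerivAt (fun y => M y r r') (M' r r') x) :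
    HasDerivAt (fun y => (Matrix.detRowAlternating : (ι → ℝ) [⋀^ι]→ₗ[ℝ] ℝ) (M y))
      (∑ r, (Matrix.detRowAlternating : (ι → ℝ) [⋀^ι]→ₗ[ℝ] ℝ)
        (Function.update (M x) r (M' r))) x := by
  have hdet : ∀ N : ι → ι → ℝ, (Matrix.detRowAlternating : (ι → ℝ) [⋀^ι]→ₗ[ℝ] ℝ) N
      = ∑ σ : Equiv.Perm ι, ((Equiv.Perm.sign σ : ℤ) : ℝ) * ∏ i, N i (σ i) := by
    intro N
    change Matrix.det (Matrix.of N) = _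
    rw [← Matrix.det_transpose, Matrix.det_apply']
    rfl
  simp only [hdet]
  rw [Finset.sum_comm]
  refine HasDerivAt.fun_sum fun σ _ => ?_
  rw [← Finset.mul_sum]
  refine HasDerivAt.const_mul _ ?_
  convert HasDerivAt.fun_finsetProd (u := Finset.univ) (fun i _ => h i (σ i)) using 1
  refine Finset.sum_congr rfl fun r _ => ?_
  rw [← Finset.mul_prod_erase _ _ (Finset.mem_univ r), Function.update_self, smul_eq_mul, mul_comm]
  congr 1
  refine Finset.prod_congr rfl fun i hi => ?_
  rw [Function.update_of_ne (Finset.ne_of_mem_erase hi)]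

section Kernel

variable {q p : ℕ} {m : Fin q → ℕ} {n : Fin p → ℕ}

/-- The block determinant with entries `μ κ l (e (κ, i) + f (l, j))`. -/
noncomputable def kernelDet (σ : (Σ κ : Fin q, Fin (m κ)) ≃ (Σ l : Fin p, Fin (n l)))
    (μ : Fin q → Fin p → ℕ → ℝ) (e : (Σ κ : Fin q, Fin (m κ)) → ℕ)
    (f : (Σ l : Fin p, Fin (n l)) → ℕ) : ℝ :=
  Matrix.det (Matrix.of fun r r' => μ r.1 (σ r').1 (e r + f (σ r')))

/-- The rows of `kernelDet`. -/
def kernelRow (σ : (Σ κ : Fin q, Fin (m κ)) ≃ (Σ l : Fin p, Fin (n l)))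
    (μ : Fin q → Fin p → ℕ → ℝ) (f : (Σ l : Fin p, Fin (n l)) → ℕ) (κ : Fin q) (a : ℕ) :
    (Σ κ : Fin q, Fin (m κ)) → ℝ :=
  fun r' => μ κ (σ r').1 (a + f (σ r'))

variable (σ : (Σ κ : Fin q, Fin (m κ)) ≃ (Σ l : Fin p, Fin (n l)))

theorem kernelDet_eq (μ : Fin q → Fin p → ℕ → ℝ) (e : (Σ κ : Fin q, Fin (m κ)) → ℕ)
    (f : (Σ l : Fin p, Fin (n l)) → ℕ) :
    kernelDet σ μ e f = Matrix.detRowAlternating (blockRows (kernelRow σ μ f) e) :=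
  rfl

theorem kernelDet_symm (μ : Fin q → Fin p → ℕ → ℝ) (e : (Σ κ : Fin q, Fin (m κ)) → ℕ)
    (f : (Σ l : Fin p, Fin (n l)) → ℕ) :
    kernelDet σ.symm (fun l κ => μ κ l) f e = kernelDet σ μ e f := by
  unfold kernelDet
  rw [← Matrix.det_transpose, ← Matrix.det_submatrix_equiv_self σ]
  congr 1
  ext r r'
  simp [add_comm]

/-- If a derivation multiplies the moments of the row block `κ` by `ε x ^ ν`, it acts on the
determinant by raising exponents in that block. -/
theorem hasDerivAt_kernelDet_row {μ : ℝ → Fin q → Fin p → ℕ → ℝ} {x ε : ℝ} {κ : Fin q} {ν : ℕ}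
    (h : ∀ κ' l a, HasDerivAt (fun y => μ y κ' l a)
      (if κ' = κ then ε * μ x κ' l (a + ν) else 0) x)
    (e : (Σ κ : Fin q, Fin (m κ)) → ℕ) (f : (Σ l : Fin p, Fin (n l)) → ℕ) :
    HasDerivAt (fun y => kernelDet σ (μ y) e f)
      (ε * ∑ i : Fin (m κ), kernelDet σ (μ x) (raiseExp e ⟨κ, i⟩ ν) f) x := by
  have key := hasDerivAt_detRowAlternating
    (M := fun y => blockRows (kernelRow σ (μ y) f) e)
    (M' := fun r => if r.1 = κ then ε • kernelRow σ (μ x) f r.1 (e r + ν) else 0) (x := x) ?_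
  · refine key.congr_deriv ?_
    rw [Fintype.sum_sigma, Finset.sum_eq_single κ, Finset.mul_sum]
    · refine Finset.sum_congr rfl fun i _ => ?_
      rw [if_pos rfl, AlternatingMap.map_update_smul, smul_eq_mul, kernelDet_eq, raiseExp,
        ← update_blockRows]
    · intro κ' _ hne
      refine Finset.sum_eq_zero fun i _ => ?_
      rw [if_neg hne, AlternatingMap.map_update_zero]
    · simp
  · intro r r'
    refine (h r.1 (σ r').1 (e r + f (σ r'))).congr_deriv ?_
    split_ifs with hr
    · simp only [Pi.smul_apply, smul_eq_mul, kernelRow]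
      congr 2
      omega
    · rfl

/-- Column version of `hasDerivAt_kernelDet_row`. -/
theorem hasDerivAt_kernelDet_col {μ : ℝ → Fin q → Fin p → ℕ → ℝ} {x ε : ℝ} {l : Fin p} {ν : ℕ}
    (h : ∀ κ l' a, HasDerivAt (fun y => μ y κ l' a)
      (if l' = l then ε * μ x κ l' (a + ν) else 0) x)
    (e : (Σ κ : Fin q, Fin (m κ)) → ℕ) (f : (Σ l : Fin p, Fin (n l)) → ℕ) :
    HasDerivAt (fun y => kernelDet σ (μ y) e f)
      (ε * ∑ j : Fin (n l), kernelDet σ (μ x) e (raiseExp f ⟨l, j⟩ ν)) x := by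
  simp only [← kernelDet_symm σ]
  exact hasDerivAt_kernelDet_row σ.symm (μ := fun y l κ => μ y κ l) (fun l' κ a => h κ l' a) f e

/-- A first-order variation of a determinant may be computed along rows or along columns. -/
theorem sum_det_update_eq_sum_det_update_symm {R C : Type*} [Fintype R] [DecidableEq R]
    [Fintype C] [DecidableEq C] (σ : R ≃ C) (M Y : R → R → ℝ) :
    ∑ r, (Matrix.detRowAlternating : (R → ℝ) [⋀^R]→ₗ[ℝ] ℝ) (Function.update M r (Y r))
      = ∑ c, (Matrix.detRowAlternating : (C → ℝ) [⋀^C]→ₗ[ℝ] ℝ)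
        (Function.update (fun c c' => M (σ.symm c') (σ.symm c)) c
          (fun c' => Y (σ.symm c') (σ.symm c))) := by
  have h1 : ∀ r r', HasDerivAt (fun y : ℝ => M r r' + y * Y r r') (Y r r') 0 := fun r r' => by
    simpa using ((hasDerivAt_id (0 : ℝ)).mul_const (Y r r')).const_add (M r r')
  have d1 := hasDerivAt_detRowAlternating (M := fun y r r' => M r r' + y * Y r r') h1
  have d2 := hasDerivAt_detRowAlternating
    (M := fun y c c' => M (σ.symm c') (σ.symm c) + y * Y (σ.symm c') (σ.symm c))
    (M' := fun c c' => Y (σ.symm c') (σ.symm c)) fun c c' => h1 _ _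
  have heq : (fun y : ℝ => (Matrix.detRowAlternating : (R → ℝ) [⋀^R]→ₗ[ℝ] ℝ)
        (fun r r' => M r r' + y * Y r r'))
      = fun y : ℝ => (Matrix.detRowAlternating : (C → ℝ) [⋀^C]→ₗ[ℝ] ℝ)
        (fun c c' => M (σ.symm c') (σ.symm c) + y * Y (σ.symm c') (σ.symm c)) := by
    ext y
    change Matrix.det (Matrix.of fun r r' => M r r' + y * Y r r') = Matrix.det (Matrix.of
      fun c c' => M (σ.symm c') (σ.symm c) + y * Y (σ.symm c') (σ.symm c))
    rw [← Matrix.det_transpose, ← Matrix.det_submatrix_equiv_self σ.symm]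
    rfl
  rw [heq] at d1
  simpa using d1.unique d2

end Kernel

/-- Differentiation of an exponential parameter under an integral over a compact set. -/
theorem hasDerivAt_setIntegral_mul_exp {K : Set ℝ} (hK : IsCompact K) {g u : ℝ → ℝ}
    (hg : Continuous g) (hu : Continuous u) (x₀ : ℝ) :
    HasDerivAt (fun y => ∫ x in K, g x * Real.exp ((y - x₀) * u x)) (∫ x in K, g x * u x) x₀ := by
  have hint : ∀ φ : ℝ → ℝ, Continuous φ → Integrable φ (volume.restrict K) :=
    fun φ hφ => hφ.continuousOn.integrableOn_compact hK
  have key := hasDerivAt_integral_of_dominated_loc_of_deriv_le (μ := volume.restrict K)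
    (F := fun y x => g x * Real.exp ((y - x₀) * u x))
    (F' := fun y x => g x * (Real.exp ((y - x₀) * u x) * u x))
    (bound := fun x => |g x| * (Real.exp |u x| * |u x|)) (x₀ := x₀)
    (Metric.ball_mem_nhds x₀ one_pos)
    (Filter.Eventually.of_forall fun y => (hint _ (by fun_prop)).aestronglyMeasurable)
    (hint _ (by fun_prop)) (hint _ (by fun_prop)).aestronglyMeasurable
    (Filter.Eventually.of_forall fun x y hy => ?_) (hint _ (by fun_prop))
    (Filter.Eventually.of_forall fun x y _ => ?_)
  · simpa using key.2
  · rw [Metric.mem_ball, Real.dist_eq] at hy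
    rw [Real.norm_eq_abs, abs_mul, abs_mul, Real.abs_exp]
    gcongr
    calc (y - x₀) * u x ≤ |(y - x₀) * u x| := le_abs_self _
      _ = |y - x₀| * |u x| := abs_mul _ _
      _ ≤ 1 * |u x| := by gcongr
      _ = |u x| := one_mul _
  · have h1 : HasDerivAt (fun y => (y - x₀) * u x) (u x) y := by
      simpa using ((hasDerivAt_id y).sub_const x₀).mul_const (u x)
    exact h1.exp.const_mul (g x)

theorem finsum_mul_pow_eq_sum {u : ℕ → ℝ} {S : Finset ℕ} (hS₁ : ∀ ν ∈ S, 1 ≤ ν)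
    (hS : ∀ ν, 1 ≤ ν → u ν ≠ 0 → ν ∈ S) (x : ℝ) :
    ∑ᶠ ν ∈ Set.Ici (1 : ℕ), u ν * x ^ ν = ∑ ν ∈ S, u ν * x ^ ν := by
  apply finsum_mem_eq_sum_of_inter_support_eq
  ext ν
  simp only [Set.mem_inter_iff, Set.mem_Ici, Function.mem_support, Finset.mem_coe]
  constructor
  · rintro ⟨h1, h2⟩
    exact ⟨hS ν h1 fun h => h2 (by simp [h]), h2⟩
  · rintro ⟨h1, h2⟩
    exact ⟨hS₁ ν h1, h2⟩

/-- The positive indices at which a finitely supported family of times is nonzero. -/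
noncomputable def timeSupport {u : ℕ → ℝ} (hu : (Function.support u).Finite) : Finset ℕ :=
  hu.toFinset.filter (1 ≤ ·)

theorem mem_timeSupport {u : ℕ → ℝ} (hu : (Function.support u).Finite) (ν : ℕ) :
    ν ∈ timeSupport hu ↔ 1 ≤ ν ∧ u ν ≠ 0 := by
  simp [timeSupport, and_comm]

theorem finsum_mul_pow_eq_sum_timeSupport {u : ℕ → ℝ} (hu : (Function.support u).Finite) (x : ℝ) :
    ∑ᶠ ν ∈ Set.Ici (1 : ℕ), u ν * x ^ ν = ∑ ν ∈ timeSupport hu, u ν * x ^ ν :=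
  finsum_mul_pow_eq_sum (fun ν h => ((mem_timeSupport hu ν).1 h).1)
    (fun ν h1 h2 => (mem_timeSupport hu ν).2 ⟨h1, h2⟩) x

theorem hasDerivAt_finsum_mul_pow {u : ℕ → ℝ} (hu : (Function.support u).Finite) (x : ℝ) :
    HasDerivAt (fun x => ∑ᶠ ν ∈ Set.Ici (1 : ℕ), u ν * x ^ ν)
      (∑ ν ∈ timeSupport hu, (ν : ℝ) * u ν * x ^ (ν - 1)) x := by
  simp only [finsum_mul_pow_eq_sum_timeSupport hu]
  refine HasDerivAt.fun_sum fun ν _ => ?_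
  refine ((hasDerivAt_pow ν x).const_mul (u ν)).congr_deriv ?_
  ring

theorem finite_support_update {u : ℕ → ℝ} (hu : (Function.support u).Finite) (ν : ℕ) (y : ℝ) :
    (Function.support (Function.update u ν y)).Finite :=
  (hu.union (Set.finite_singleton ν)).subset fun ν' h => by
    by_cases hν : ν' = ν
    · exact Or.inr hν
    · rw [Function.mem_support, Function.update_of_ne hν] at h
      exact Or.inl h

theorem finsum_update_mul_pow {u : ℕ → ℝ} (hu : (Function.support u).Finite) {ν : ℕ} (hν : 1 ≤ ν)
    (y x : ℝ) :
    ∑ᶠ ν' ∈ Set.Ici (1 : ℕ), Function.update u ν y ν' * x ^ ν'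
      = (∑ᶠ ν' ∈ Set.Ici (1 : ℕ), u ν' * x ^ ν') + (y - u ν) * x ^ ν := by
  have h1 : ∀ ν' ∈ insert ν (timeSupport hu), 1 ≤ ν' := by
    intro ν' h
    rcases Finset.mem_insert.1 h with rfl | h
    · exact hν
    · exact ((mem_timeSupport hu ν').1 h).1
  rw [finsum_mul_pow_eq_sum h1, finsum_mul_pow_eq_sum h1]
  · have h2 : ∀ ν' ∈ insert ν (timeSupport hu), Function.update u ν y ν' * x ^ ν'
        = u ν' * x ^ ν' + if ν' = ν then (y - u ν) * x ^ ν else 0 := by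
      intro ν' _
      by_cases h : ν' = ν
      · subst h; simp; ring
      · simp [h]
    rw [Finset.sum_congr rfl h2, Finset.sum_add_distrib, Finset.sum_ite_eq',
      if_pos (Finset.mem_insert_self _ _)]
  · exact fun ν' h h' => Finset.mem_insert_of_mem ((mem_timeSupport hu ν').2 ⟨h, h'⟩)
  · intro ν' h h'
    by_cases hh : ν' = ν
    · exact hh ▸ Finset.mem_insert_self _ _
    · rw [Function.update_of_ne hh] at h'
      exact Finset.mem_insert_of_mem ((mem_timeSupport hu ν').2 ⟨h, h'⟩)

theorem isCompact_Eset {r : ℕ} (c : Fin (2 * r) → ℝ) : IsCompact (Eset c) :=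
  isCompact_iUnion fun _ => isCompact_Icc

section Moments

variable {q p r : ℕ}

/-- Only finitely many of the times are nonzero. -/
def Par.FiniteTimes (P : Par q p r) : Prop :=
  (∀ i, (Function.support (P.s i)).Finite) ∧ ∀ i, (Function.support (P.t i)).Finite

/-- The exponent of the weight of the block `(κ, l)`. -/
noncomputable def blockExponent (P : Par q p r) (κ : Fin q) (l : Fin p) (x : ℝ) : ℝ :=
  (P.a κ + P.b l) * x + (P.al κ + P.be l) * x ^ 2
    - (∑ᶠ ν ∈ Set.Ici (1 : ℕ), P.s κ ν * x ^ ν)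
    + (∑ᶠ ν ∈ Set.Ici (1 : ℕ), P.t l ν * x ^ ν) - x ^ 2 / 2

/-- The moments of the block `(κ, l)`. -/
noncomputable def blockMoment (P : Par q p r) (κ : Fin q) (l : Fin p) (a : ℕ) : ℝ :=
  ∫ x in Eset P.c, x ^ a * Real.exp (blockExponent P κ l x)

theorem hasDerivAt_blockExponent {P : Par q p r} (hP : P.FiniteTimes) (κ : Fin q) (l : Fin p)
    (x : ℝ) :
    HasDerivAt (blockExponent P κ l) ((P.a κ + P.b l) + 2 * (P.al κ + P.be l) * x
      - (∑ ν ∈ timeSupport (hP.1 κ), (ν : ℝ) * P.s κ ν * x ^ (ν - 1))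
      + (∑ ν ∈ timeSupport (hP.2 l), (ν : ℝ) * P.t l ν * x ^ (ν - 1)) - x) x := by
  have h1 : HasDerivAt (fun x => (P.a κ + P.b l) * x) (P.a κ + P.b l) x := by
    simpa using (hasDerivAt_id x).const_mul (P.a κ + P.b l)
  have h2 := (hasDerivAt_pow 2 x).const_mul (P.al κ + P.be l)
  have h3 := (hasDerivAt_pow 2 x).div_const 2
  refine ((((h1.add h2).sub (hasDerivAt_finsum_mul_pow (hP.1 κ) x)).add
    (hasDerivAt_finsum_mul_pow (hP.2 l) x)).sub h3).congr_deriv ?_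
  simp
  ring

theorem continuous_blockExponent {P : Par q p r} (hP : P.FiniteTimes) (κ : Fin q) (l : Fin p) :
    Continuous (blockExponent P κ l) :=
  continuous_iff_continuousAt.2 fun x => (hasDerivAt_blockExponent hP κ l x).continuousAt

theorem Par.FiniteTimes.update_s {P : Par q p r} (hP : P.FiniteTimes) (κ : Fin q) (ν : ℕ) (y : ℝ) :
    Par.FiniteTimes
      { P with s := Function.update P.s κ (Function.update (P.s κ) ν y) } := by
  refine ⟨fun i => ?_, hP.2⟩
  by_cases h : i = κ
  · subst h; simpa using finite_support_update (hP.1 i) ν y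
  · simpa [h] using hP.1 i

theorem Par.FiniteTimes.update_t {P : Par q p r} (hP : P.FiniteTimes) (l : Fin p) (ν : ℕ) (y : ℝ) :
    Par.FiniteTimes
      { P with t := Function.update P.t l (Function.update (P.t l) ν y) } := by
  refine ⟨hP.1, fun i => ?_⟩
  by_cases h : i = l
  · subst h; simpa using finite_support_update (hP.2 i) ν y
  · simpa [h] using hP.2 i

theorem hasDerivAt_blockMoment_s {P : Par q p r} (hP : P.FiniteTimes) (κ : Fin q) {ν : ℕ}
    (hν : 1 ≤ ν) (κ' : Fin q) (l : Fin p) (a : ℕ) :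
    HasDerivAt (fun y => blockMoment
      { P with s := Function.update P.s κ (Function.update (P.s κ) ν y) } κ' l a)
      (if κ' = κ then -1 * blockMoment P κ' l (a + ν) else 0) (P.s κ ν) := by
  by_cases h : κ' = κ
  · subst h
    have key := hasDerivAt_setIntegral_mul_exp (isCompact_Eset P.c)
      (g := fun x => x ^ a * Real.exp (blockExponent P κ' l x)) (u := fun x => -x ^ ν)
      (by have := continuous_blockExponent hP κ' l; fun_prop) (by fun_prop) (P.s κ' ν)
    rw [if_pos rfl, blockMoment, ← integral_const_mul]
    convert key using 1
    · ext y
      refine integral_congr_ae (Filter.Eventually.of_forall fun x => ?_)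
      simp only [blockExponent, Function.update_self, finsum_update_mul_pow (hP.1 κ') hν]
      rw [mul_assoc, ← Real.exp_add]
      congr 2
      ring
    · congr 1
      ext x
      ring
  · rw [if_neg h]
    simp only [blockMoment, blockExponent, Function.update_of_ne h]
    exact hasDerivAt_const _ _

theorem hasDerivAt_blockMoment_t {P : Par q p r} (hP : P.FiniteTimes) (l : Fin p) {ν : ℕ}
    (hν : 1 ≤ ν) (κ : Fin q) (l' : Fin p) (a : ℕ) :
    HasDerivAt (fun y => blockMoment
      { P with t := Function.update P.t l (Function.update (P.t l) ν y) } κ l' a)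
      (if l' = l then 1 * blockMoment P κ l' (a + ν) else 0) (P.t l ν) := by
  by_cases h : l' = l
  · subst h
    have key := hasDerivAt_setIntegral_mul_exp (isCompact_Eset P.c)
      (g := fun x => x ^ a * Real.exp (blockExponent P κ l' x)) (u := fun x => x ^ ν)
      (by have := continuous_blockExponent hP κ l'; fun_prop) (by fun_prop) (P.t l' ν)
    rw [if_pos rfl, blockMoment, ← integral_const_mul]
    convert key using 1
    · ext y
      refine integral_congr_ae (Filter.Eventually.of_forall fun x => ?_)
      simp only [blockExponent, Function.update_self, finsum_update_mul_pow (hP.2 l') hν]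
      rw [mul_assoc, ← Real.exp_add]
      congr 2
      ring
    · congr 1
      ext x
      ring
  · rw [if_neg h]
    simp only [blockMoment, blockExponent, Function.update_of_ne h]
    exact hasDerivAt_const _ _

variable {m : Fin q → ℕ} {n : Fin p → ℕ}
  (σ : (Σ κ : Fin q, Fin (m κ)) ≃ (Σ l : Fin p, Fin (n l)))

theorem hasDerivAt_kernelDet_s {P : Par q p r} (hP : P.FiniteTimes) (κ : Fin q) {ν : ℕ}
    (hν : 1 ≤ ν) (e : (Σ κ : Fin q, Fin (m κ)) → ℕ) (f : (Σ l : Fin p, Fin (n l)) → ℕ) :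
    HasDerivAt (fun y => kernelDet σ (blockMoment
      { P with s := Function.update P.s κ (Function.update (P.s κ) ν y) }) e f)
      (-∑ i : Fin (m κ), kernelDet σ (blockMoment P) (raiseExp e ⟨κ, i⟩ ν) f) (P.s κ ν) := by
  have h := hasDerivAt_kernelDet_row σ (x := P.s κ ν) (ε := -1) (κ := κ) (ν := ν)
    (μ := fun y => blockMoment
      { P with s := Function.update P.s κ (Function.update (P.s κ) ν y) })
    (fun κ' l a => by
      simpa only [Function.update_eq_self] using hasDerivAt_blockMoment_s hP κ hν κ' l a) e f
  simpa only [Function.update_eq_self, neg_one_mul] using h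

theorem hasDerivAt_kernelDet_t {P : Par q p r} (hP : P.FiniteTimes) (l : Fin p) {ν : ℕ}
    (hν : 1 ≤ ν) (e : (Σ κ : Fin q, Fin (m κ)) → ℕ) (f : (Σ l : Fin p, Fin (n l)) → ℕ) :
    HasDerivAt (fun y => kernelDet σ (blockMoment
      { P with t := Function.update P.t l (Function.update (P.t l) ν y) }) e f)
      (∑ j : Fin (n l), kernelDet σ (blockMoment P) e (raiseExp f ⟨l, j⟩ ν)) (P.t l ν) := by
  have h := hasDerivAt_kernelDet_col σ (x := P.t l ν) (ε := 1) (l := l) (ν := ν)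
    (μ := fun y => blockMoment
      { P with t := Function.update P.t l (Function.update (P.t l) ν y) })
    (fun κ l' a => by
      simpa only [Function.update_eq_self] using hasDerivAt_blockMoment_t hP l hν κ l' a) e f
  simpa only [Function.update_eq_self, one_mul] using h

theorem dSp_kernelDet {P : Par q p r} (hP : P.FiniteTimes) (κ : Fin q) {ν : ℕ} (hν : 1 ≤ ν)
    (e : (Σ κ : Fin q, Fin (m κ)) → ℕ) (f : (Σ l : Fin p, Fin (n l)) → ℕ) :
    dSp κ ν (fun P => kernelDet σ (blockMoment P) e f) P
      = -∑ i : Fin (m κ), kernelDet σ (blockMoment P) (raiseExp e ⟨κ, i⟩ ν) f :=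
  (hasDerivAt_kernelDet_s σ hP κ hν e f).deriv

theorem dTp_kernelDet {P : Par q p r} (hP : P.FiniteTimes) (l : Fin p) {ν : ℕ} (hν : 1 ≤ ν)
    (e : (Σ κ : Fin q, Fin (m κ)) → ℕ) (f : (Σ l : Fin p, Fin (n l)) → ℕ) :
    dTp l ν (fun P => kernelDet σ (blockMoment P) e f) P
      = ∑ j : Fin (n l), kernelDet σ (blockMoment P) e (raiseExp f ⟨l, j⟩ ν) :=
  (hasDerivAt_kernelDet_t σ hP l hν e f).deriv

theorem dSp_dSp_kernelDet {P : Par q p r} (hP : P.FiniteTimes) (κ : Fin q) {ν ν' : ℕ}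
    (hν : 1 ≤ ν) (hν' : 1 ≤ ν')
    (e : (Σ κ : Fin q, Fin (m κ)) → ℕ) (f : (Σ l : Fin p, Fin (n l)) → ℕ) :
    dSp κ ν (dSp κ ν' fun P => kernelDet σ (blockMoment P) e f) P
      = ∑ i : Fin (m κ), ∑ i' : Fin (m κ),
        kernelDet σ (blockMoment P) (raiseExp (raiseExp e ⟨κ, i⟩ ν') ⟨κ, i'⟩ ν) f := by
  have h1 := fun y => dSp_kernelDet σ (hP.update_s κ ν y) κ hν' e f
  rw [dSp]
  simp only [h1]
  refine (HasDerivAt.fun_neg (HasDerivAt.fun_sum fun i _ =>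
    hasDerivAt_kernelDet_s σ hP κ hν (raiseExp e ⟨κ, i⟩ ν') f)).deriv.trans ?_
  simp

theorem dTp_dTp_kernelDet {P : Par q p r} (hP : P.FiniteTimes) (l : Fin p) {ν ν' : ℕ}
    (hν : 1 ≤ ν) (hν' : 1 ≤ ν')
    (e : (Σ κ : Fin q, Fin (m κ)) → ℕ) (f : (Σ l : Fin p, Fin (n l)) → ℕ) :
    dTp l ν (dTp l ν' fun P => kernelDet σ (blockMoment P) e f) P
      = ∑ j : Fin (n l), ∑ j' : Fin (n l),
        kernelDet σ (blockMoment P) e (raiseExp (raiseExp f ⟨l, j⟩ ν') ⟨l, j'⟩ ν) := by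
  have h1 := fun y => dTp_kernelDet σ (hP.update_t l ν y) l hν' e f
  rw [dTp]
  simp only [h1]
  exact (HasDerivAt.fun_sum fun j _ =>
    hasDerivAt_kernelDet_t σ hP l hν e (raiseExp f ⟨l, j⟩ ν')).deriv

end Moments

theorem sum_fin_two_mul {r : ℕ} (g : Fin (2 * r) → ℝ) :
    ∑ i, g i = ∑ j : Fin r, (g ⟨2 * (j : ℕ), by have := j.isLt; omega⟩
      + g ⟨2 * (j : ℕ) + 1, by have := j.isLt; omega⟩) := by
  have hrange : ∀ (G : ℕ → ℝ) (N : ℕ), ∑ k ∈ Finset.range (2 * N), G k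
      = ∑ j ∈ Finset.range N, (G (2 * j) + G (2 * j + 1)) := by
    intro G N
    induction N with
    | zero => simp
    | succ N ih =>
      rw [Finset.sum_range_succ, ← ih, Nat.mul_succ, Finset.sum_range_succ, Finset.sum_range_succ,
        add_assoc]
  have h := hrange (fun k => if h : k < 2 * r then g ⟨k, h⟩ else 0) r
  rw [Finset.sum_range, Finset.sum_range] at h
  simp only [Fin.is_lt, dite_true, Fin.eta] at h
  rw [h]
  refine Finset.sum_congr rfl fun j _ => ?_
  have := j.isLt
  rw [dif_pos (by omega), dif_pos (by omega)]

/-- The orientation of an endpoint: negative for left endpoints, positive for right endpoints. -/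
def edgeSign {r : ℕ} (i : Fin (2 * r)) : ℝ :=
  if (i : ℕ) % 2 = 0 then -1 else 1

theorem sum_edgeSign_mul {r : ℕ} (g : Fin (2 * r) → ℝ) :
    ∑ i, edgeSign i * g i = ∑ j : Fin r, (g ⟨2 * (j : ℕ) + 1, by have := j.isLt; omega⟩
      - g ⟨2 * (j : ℕ), by have := j.isLt; omega⟩) := by
  rw [sum_fin_two_mul]
  refine Finset.sum_congr rfl fun j _ => ?_
  simp [edgeSign, Nat.add_mod]
  ring

theorem setIntegral_Eset {r : ℕ} {c : Fin (2 * r) → ℝ} (hc : StrictMono c) {g : ℝ → ℝ}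
    (hg : Continuous g) :
    ∫ x in Eset c, g x = ∑ i, edgeSign i * ∫ x in (0 : ℝ)..c i, g x := by
  rw [sum_edgeSign_mul, Eset, integral_iUnion_fintype (fun _ => measurableSet_Icc)]
  · refine Finset.sum_congr rfl fun j _ => ?_
    rw [intervalIntegral.integral_interval_sub_left (hg.intervalIntegrable _ _)
      (hg.intervalIntegrable _ _), intervalIntegral.integral_of_le, integral_Icc_eq_integral_Ioc]
    exact hc.monotone (by rw [Fin.mk_le_mk]; omega)
  · have hdisj : ∀ i j : Fin r, i < j → Disjoint
        (Set.Icc (c ⟨2 * (i : ℕ), by have := i.isLt; omega⟩)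
          (c ⟨2 * (i : ℕ) + 1, by have := i.isLt; omega⟩))
        (Set.Icc (c ⟨2 * (j : ℕ), by have := j.isLt; omega⟩)
          (c ⟨2 * (j : ℕ) + 1, by have := j.isLt; omega⟩)) := by
      intro i j hij
      rw [Set.disjoint_left]
      intro x hx hx'
      have hlt : c ⟨2 * (i : ℕ) + 1, by have := i.isLt; omega⟩
          < c ⟨2 * (j : ℕ), by have := j.isLt; omega⟩ :=
        hc (by rw [Fin.mk_lt_mk]; have : (i : ℕ) < j := hij; omega)
      exact absurd (hx.2.trans_lt hlt) (not_lt.2 hx'.1)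
    intro i j hij
    rcases lt_or_gt_of_ne hij with h | h
    · exact hdisj i j h
    · exact (hdisj j i h).symm
  · exact fun j => hg.continuousOn.integrableOn_compact isCompact_Icc

theorem eventually_strictMono_update {N : ℕ} {c : Fin N → ℝ} (hc : StrictMono c) (i : Fin N) :
    ∀ᶠ y in nhds (c i), StrictMono (Function.update c i y) := by
  have h : ∀ a b : Fin N, a < b →
      ∀ᶠ y in nhds (c i), Function.update c i y a < Function.update c i y b := by
    intro a b hab
    have hcont : ∀ a, ContinuousAt (fun y => Function.update c i y a) (c i) := by
      intro a
      by_cases h : a = i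
      · subst h; simpa using continuousAt_id' (c a)
      · simpa [Function.update_of_ne h] using continuousAt_const
    refine (hcont a).eventually_lt (hcont b) ?_
    simpa using hc hab
  have h' : ∀ᶠ y in nhds (c i), ∀ a b : Fin N, a < b →
      Function.update c i y a < Function.update c i y b := by
    rw [Filter.eventually_all]; intro a
    rw [Filter.eventually_all]; intro b
    by_cases hab : a < b
    · exact (h a b hab).mono fun y hy _ => hy
    · exact Filter.Eventually.of_forall fun y hy => absurd hy hab
  exact h'.mono fun y hy a b hab => hy a b hab

theorem hasDerivAt_setIntegral_Eset {r : ℕ} {c : Fin (2 * r) → ℝ} (hc : StrictMono c) {g : ℝ → ℝ}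
    (hg : Continuous g) (i : Fin (2 * r)) :
    HasDerivAt (fun y => ∫ x in Eset (Function.update c i y), g x) (edgeSign i * g (c i)) (c i) := by
  have heq : (fun y => ∫ x in Eset (Function.update c i y), g x)
      =ᶠ[nhds (c i)] fun y => ∑ j, edgeSign j * ∫ x in (0 : ℝ)..Function.update c i y j, g x :=
    (eventually_strictMono_update hc i).mono fun y hy => setIntegral_Eset hy hg
  refine HasDerivAt.congr_of_eventuallyEq ?_ heq
  have hsum : edgeSign i * g (c i) = ∑ j, if j = i then edgeSign i * g (c i) else 0 := by simp
  rw [hsum]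
  refine HasDerivAt.fun_sum fun j _ => ?_
  by_cases h : j = i
  · subst h
    simp only [Function.update_self, if_true]
    exact (hg.integral_hasStrictDerivAt 0 (c j)).hasDerivAt.const_mul _
  · simp only [Function.update_of_ne h, if_neg h]
    exact hasDerivAt_const _ _

theorem setIntegral_Eset_of_hasDerivAt {r : ℕ} {c : Fin (2 * r) → ℝ} (hc : StrictMono c)
    {G g : ℝ → ℝ} (hG : ∀ x, HasDerivAt G (g x) x) (hg : Continuous g) :
    ∫ x in Eset c, g x = ∑ i, edgeSign i * G (c i) := by
  rw [setIntegral_Eset hc hg, sum_edgeSign_mul, sum_edgeSign_mul]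
  refine Finset.sum_congr rfl fun j _ => ?_
  rw [intervalIntegral.integral_eq_sub_of_hasDerivAt (fun x _ => hG x) (hg.intervalIntegrable _ _),
    intervalIntegral.integral_eq_sub_of_hasDerivAt (fun x _ => hG x) (hg.intervalIntegrable _ _)]
  ring

section Boundary

variable {q p r : ℕ}

theorem hasDerivAt_blockMoment_c {P : Par q p r} (hP : P.FiniteTimes) (hc : StrictMono P.c)
    (i : Fin (2 * r)) (κ : Fin q) (l : Fin p) (a : ℕ) :
    HasDerivAt (fun y => blockMoment { P with c := Function.update P.c i y } κ l a)
      (edgeSign i * (P.c i ^ a * Real.exp (blockExponent P κ l (P.c i)))) (P.c i) := by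
  have hE := continuous_blockExponent hP κ l
  exact hasDerivAt_setIntegral_Eset hc
    (g := fun x => x ^ a * Real.exp (blockExponent P κ l x)) (by fun_prop) i

/-- Integration by parts: the boundary operator acting on a moment. -/
theorem sum_edge_pow_mul_moment {P : Par q p r} (hP : P.FiniteTimes) (hc : StrictMono P.c)
    (κ : Fin q) (l : Fin p) (a b K : ℕ) :
    ∑ i, P.c i ^ K * (edgeSign i * (P.c i ^ (a + b) * Real.exp (blockExponent P κ l (P.c i))))
      = (((a : ℝ) + K) * blockMoment P κ l (a + K - 1 + b)
          + P.a κ * blockMoment P κ l (a + K + b)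
          + (-(1 - 2 * P.al κ)) * blockMoment P κ l (a + (K + 1) + b)
          + ∑ ν ∈ timeSupport (hP.1 κ),
            ((ν : ℝ) * -P.s κ ν) * blockMoment P κ l (a + (K + ν - 1) + b))
        + (((b : ℝ) + 0) * blockMoment P κ l (b + K - 1 + a)
          + P.b l * blockMoment P κ l (b + K + a)
          + 2 * P.be l * blockMoment P κ l (b + (K + 1) + a)
          + ∑ ν ∈ timeSupport (hP.2 l),
            ((ν : ℝ) * P.t l ν) * blockMoment P κ l (b + (K + ν - 1) + a)) := by
  have hE := continuous_blockExponent hP κ l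
  have hint : ∀ φ : ℝ → ℝ, Continuous φ → Integrable φ (volume.restrict (Eset P.c)) :=
    fun φ hφ => hφ.continuousOn.integrableOn_compact (isCompact_Eset P.c)
  have hG := fun x : ℝ => (hasDerivAt_pow (a + b + K) x).mul (hasDerivAt_blockExponent hP κ l x).exp
  have hfun := setIntegral_Eset_of_hasDerivAt hc hG (by fun_prop)
  have hL : ∑ i, P.c i ^ K *
      (edgeSign i * (P.c i ^ (a + b) * Real.exp (blockExponent P κ l (P.c i))))
      = ∑ i, edgeSign i * (((fun x : ℝ => x ^ (a + b + K))
        * fun x => Real.exp (blockExponent P κ l x)) (P.c i)) := by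
    refine Finset.sum_congr rfl fun i _ => ?_
    simp only [Pi.mul_apply]
    ring
  rw [hL, ← hfun]
  simp only [blockMoment, ← integral_const_mul]
  rw [← integral_finsetSum, ← integral_finsetSum, ← integral_add, ← integral_add, ← integral_add,
    ← integral_add, ← integral_add, ← integral_add, ← integral_add]
  rotate_left
  all_goals first
    | exact hint _ (by fun_prop)
    | exact fun i _ => hint _ (by fun_prop)
    | skip
  refine integral_congr_ae (Filter.Eventually.of_forall fun x => ?_)
  have h1 : ((a + b + K : ℕ) : ℝ) * x ^ (a + b + K - 1)
      = ((a : ℝ) + K) * x ^ (a + K - 1 + b) + b * x ^ (b + K - 1 + a) := by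
    have ha : ((a : ℝ) + K) * x ^ (a + K - 1 + b) = ((a : ℝ) + K) * x ^ (a + b + K - 1) := by
      rcases Nat.eq_zero_or_pos (a + K) with h | h
      · rw [← Nat.cast_add, h]; simp
      · congr 2; omega
    have hb : (b : ℝ) * x ^ (b + K - 1 + a) = b * x ^ (a + b + K - 1) := by
      rcases Nat.eq_zero_or_pos b with h | h
      · simp [h]
      · congr 2; omega
    rw [ha, hb]; push_cast; ring
  have h2 : ∀ ν ∈ timeSupport (hP.1 κ), ((ν : ℝ) * -P.s κ ν) *
      (x ^ (a + (K + ν - 1) + b) * Real.exp (blockExponent P κ l x))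
      = -(x ^ (a + b + K) * Real.exp (blockExponent P κ l x))
        * ((ν : ℝ) * P.s κ ν * x ^ (ν - 1)) := by
    intro ν hν
    have := ((mem_timeSupport _ _).1 hν).1
    rw [show a + (K + ν - 1) + b = (a + b + K) + (ν - 1) by omega, pow_add]
    ring
  have h3 : ∀ ν ∈ timeSupport (hP.2 l), ((ν : ℝ) * P.t l ν) *
      (x ^ (b + (K + ν - 1) + a) * Real.exp (blockExponent P κ l x))
      = (x ^ (a + b + K) * Real.exp (blockExponent P κ l x))
        * ((ν : ℝ) * P.t l ν * x ^ (ν - 1)) := by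
    intro ν hν
    have := ((mem_timeSupport _ _).1 hν).1
    rw [show b + (K + ν - 1) + a = (a + b + K) + (ν - 1) by omega, pow_add]
    ring
  dsimp only
  rw [h1, Finset.sum_congr rfl h2, Finset.sum_congr rfl h3, ← Finset.mul_sum, ← Finset.mul_sum]
  ring

end Boundary

section Tau

variable {q p r : ℕ} {m : Fin q → ℕ} {n : Fin p → ℕ}

/-- The identification of the rows and the columns of the moment matrix. -/
noncomputable def rowColEquiv (hsum : ∑ l, n l = ∑ i, m i) :
    (Σ κ : Fin q, Fin (m κ)) ≃ (Σ l : Fin p, Fin (n l)) :=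
  ((blkEquiv m).trans (finCongr hsum.symm)).trans (blkEquiv n).symm

theorem tauPar_eq_kernelDet (hsum : ∑ l, n l = ∑ i, m i) :
    (tauPar m n : Par q p r → ℝ) = fun P => kernelDet (rowColEquiv hsum) (blockMoment P)
      (fun r => (r.2 : ℕ)) (fun c => (c.2 : ℕ)) := by
  ext P
  rw [tauPar, tauGen, dif_pos hsum, ← Matrix.det_submatrix_equiv_self (blkEquiv m)]
  unfold kernelDet
  congr 1
  ext r r'
  simp only [Matrix.submatrix_apply, Matrix.of_apply]
  rw [Equiv.symm_apply_apply]
  rfl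

/-- The rows of the moment matrix. -/
noncomputable def tauRow (hsum : ∑ l, n l = ∑ i, m i) (P : Par q p r) :
    Fin q → ℕ → (Σ κ : Fin q, Fin (m κ)) → ℝ :=
  kernelRow (rowColEquiv hsum) (blockMoment P) fun c => (c.2 : ℕ)

/-- The columns of the moment matrix. -/
noncomputable def tauCol (hsum : ∑ l, n l = ∑ i, m i) (P : Par q p r) :
    Fin p → ℕ → (Σ l : Fin p, Fin (n l)) → ℝ :=
  kernelRow (rowColEquiv hsum).symm (fun l κ => blockMoment P κ l) fun c => (c.2 : ℕ)

variable (hsum : ∑ l, n l = ∑ i, m i) {P : Par q p r}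

theorem tauPar_eq_row : tauPar m n P
    = Matrix.detRowAlternating (blockRows (tauRow hsum P) fun r => (r.2 : ℕ)) := by
  rw [tauPar_eq_kernelDet hsum]; rfl

theorem tauPar_eq_col : tauPar m n P
    = Matrix.detRowAlternating (blockRows (tauCol hsum P) fun r => (r.2 : ℕ)) := by
  rw [tauPar_eq_kernelDet hsum]
  exact (kernelDet_symm _ _ _ _).symm

theorem dSp_tauPar (hP : P.FiniteTimes) (κ : Fin q) {ν : ℕ} (hν : 1 ≤ ν) :
    dSp κ ν (tauPar m n) P = -raiseSum Matrix.detRowAlternating (tauRow hsum P) κ ν := by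
  rw [tauPar_eq_kernelDet hsum, dSp_kernelDet _ hP κ hν]; rfl

theorem dTp_tauPar (hP : P.FiniteTimes) (l : Fin p) {ν : ℕ} (hν : 1 ≤ ν) :
    dTp l ν (tauPar m n) P = raiseSum Matrix.detRowAlternating (tauCol hsum P) l ν := by
  rw [tauPar_eq_kernelDet hsum, dTp_kernelDet _ hP l hν]
  exact Finset.sum_congr rfl fun j _ => (kernelDet_symm _ _ _ _).symm

theorem dSp_dSp_tauPar (hP : P.FiniteTimes) (κ : Fin q) {ν ν' : ℕ} (hν : 1 ≤ ν) (hν' : 1 ≤ ν') :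
    dSp κ ν (dSp κ ν' (tauPar m n)) P
      = raiseSum₂ Matrix.detRowAlternating (tauRow hsum P) κ ν ν' := by
  rw [tauPar_eq_kernelDet hsum, dSp_dSp_kernelDet _ hP κ hν hν']; rfl

theorem dTp_dTp_tauPar (hP : P.FiniteTimes) (l : Fin p) {ν ν' : ℕ} (hν : 1 ≤ ν) (hν' : 1 ≤ ν') :
    dTp l ν (dTp l ν' (tauPar m n)) P
      = raiseSum₂ Matrix.detRowAlternating (tauCol hsum P) l ν ν' := by
  rw [tauPar_eq_kernelDet hsum, dTp_dTp_kernelDet _ hP l hν hν']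
  exact Finset.sum_congr rfl fun j _ => Finset.sum_congr rfl fun j' _ =>
    (kernelDet_symm _ _ _ _).symm

theorem J1Sp_tauPar (hP : P.FiniteTimes) (κ : Fin q) {mm : ℤ} (K : ℕ) (hK : mm = K) :
    J1Sp κ mm ((m κ : ℕ) : ℝ) (tauPar m n) P
      = raiseSum Matrix.detRowAlternating (tauRow hsum P) κ K := by
  subst hK
  rcases Nat.eq_zero_or_pos K with rfl | h
  · simp [J1Sp, raiseSum_zero, tauPar_eq_row hsum]
  · simp [J1Sp, h, h.ne', dSp_tauPar hsum hP κ h]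

theorem J1Tp_tauPar (hP : P.FiniteTimes) (l : Fin p) {mm : ℤ} (K : ℕ) (hK : mm = K) :
    J1Tp l mm ((n l : ℕ) : ℝ) (tauPar m n) P
      = raiseSum Matrix.detRowAlternating (tauCol hsum P) l K := by
  subst hK
  rcases Nat.eq_zero_or_pos K with rfl | h
  · simp [J1Tp, raiseSum_zero, tauPar_eq_col hsum]
  · simp [J1Tp, h, h.ne', dTp_tauPar hsum hP l h]

theorem J2Sp_tauPar (hP : P.FiniteTimes) (κ : Fin q) {k : ℤ} {K : ℕ} (hK : k = (K : ℤ) - 1) :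
    J2Sp κ k ((m κ : ℕ) : ℝ) (tauPar m n) P
      = wittSum Matrix.detRowAlternating (tauRow hsum P) κ K K
        + ∑ ν ∈ timeSupport (hP.1 κ), (ν : ℝ) * -P.s κ ν *
          raiseSum Matrix.detRowAlternating (tauRow hsum P) κ (K + ν - 1) := by
  have hite : ∀ z : ℤ, (if 0 < z then dSp κ z.toNat (tauPar m n) P else 0)
      = -(if 0 < z then raiseSum Matrix.detRowAlternating (tauRow hsum P) κ z.toNat else 0) := by
    intro z
    split_ifs with h
    · exact dSp_tauPar hsum hP κ (by omega)
    · simp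
  have hdbl : ∑ i ∈ Finset.Icc (1 : ℤ) (k - 1), dSp κ i.toNat (dSp κ (k - i).toNat (tauPar m n)) P
      = ∑ i ∈ Finset.Icc (1 : ℤ) (k - 1),
        raiseSum₂ Matrix.detRowAlternating (tauRow hsum P) κ i.toNat (k - i).toNat := by
    refine Finset.sum_congr rfl fun i hi => ?_
    rw [Finset.mem_Icc] at hi
    exact dSp_dSp_tauPar hsum hP κ (by omega) (by omega)
  have hneg : (if 0 < -k then -P.s κ (-k).toNat else 0)
      = -(if 0 < -k then P.s κ (-k).toNat else 0) := by
    split_ifs <;> simp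
  have key := virasoro_current_eq Matrix.detRowAlternating (tauRow hsum P) κ
    (fun ν => -P.s κ ν) (timeSupport (hP.1 κ)) (fun ν => by simp [mem_timeSupport]) k K hK
  rw [← key, ← tauPar_eq_row hsum, hneg]
  simp only [J2Sp, hite, hdbl, mul_neg, neg_mul, neg_neg]

theorem J2Tp_tauPar (hP : P.FiniteTimes) (l : Fin p) {k : ℤ} {K : ℕ} (hK : k = (K : ℤ) - 1) :
    J2Tp l k ((n l : ℕ) : ℝ) (tauPar m n) P
      = wittSum Matrix.detRowAlternating (tauCol hsum P) l K K
        + ∑ ν ∈ timeSupport (hP.2 l), (ν : ℝ) * P.t l ν *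
          raiseSum Matrix.detRowAlternating (tauCol hsum P) l (K + ν - 1) := by
  have hite : ∀ z : ℤ, (if 0 < z then dTp l z.toNat (tauPar m n) P else 0)
      = if 0 < z then raiseSum Matrix.detRowAlternating (tauCol hsum P) l z.toNat else 0 := by
    intro z
    split_ifs with h
    · exact dTp_tauPar hsum hP l (by omega)
    · rfl
  have hdbl : ∑ i ∈ Finset.Icc (1 : ℤ) (k - 1), dTp l i.toNat (dTp l (k - i).toNat (tauPar m n)) P
      = ∑ i ∈ Finset.Icc (1 : ℤ) (k - 1),
        raiseSum₂ Matrix.detRowAlternating (tauCol hsum P) l i.toNat (k - i).toNat := by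
    refine Finset.sum_congr rfl fun i hi => ?_
    rw [Finset.mem_Icc] at hi
    exact dTp_dTp_tauPar hsum hP l (by omega) (by omega)
  have key := virasoro_current_eq Matrix.detRowAlternating (tauCol hsum P) l
    (P.t l) (timeSupport (hP.2 l)) (mem_timeSupport _) k K hK
  rw [← key, ← tauPar_eq_col hsum]
  simp only [J2Tp, hite, hdbl]

theorem Vpar_tauPar (hP : P.FiniteTimes) {k : ℤ} {K : ℕ} (hK : k = (K : ℤ) - 1) :
    Vpar m n k (tauPar m n) P
      = ∑ κ, (wittSum Matrix.detRowAlternating (tauRow hsum P) κ K K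
          + P.a κ * raiseSum Matrix.detRowAlternating (tauRow hsum P) κ K
          + (-(1 - 2 * P.al κ)) * raiseSum Matrix.detRowAlternating (tauRow hsum P) κ (K + 1)
          + ∑ ν ∈ timeSupport (hP.1 κ), (ν : ℝ) * -P.s κ ν *
            raiseSum Matrix.detRowAlternating (tauRow hsum P) κ (K + ν - 1))
        + ∑ l, (wittSum Matrix.detRowAlternating (tauCol hsum P) l 0 K
          + P.b l * raiseSum Matrix.detRowAlternating (tauCol hsum P) l K
          + 2 * P.be l * raiseSum Matrix.detRowAlternating (tauCol hsum P) l (K + 1)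
          + ∑ ν ∈ timeSupport (hP.2 l), (ν : ℝ) * P.t l ν *
            raiseSum Matrix.detRowAlternating (tauCol hsum P) l (K + ν - 1)) := by
  have hwitt : ∀ l, wittSum Matrix.detRowAlternating (tauCol hsum P) l K K
      = wittSum Matrix.detRowAlternating (tauCol hsum P) l 0 K
        + ((k : ℝ) + 1) * J1Tp l k ((n l : ℕ) : ℝ) (tauPar m n) P := by
    intro l
    rcases K with _ | K
    · have : (k : ℝ) + 1 = 0 := by rw [hK]; simp
      rw [this]; simp
    · rw [J1Tp_tauPar hsum hP l K (by push_cast at hK; omega), wittSum_succ, hK]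
      push_cast; ring
  rw [Vpar]
  congr 1
  · refine Finset.sum_congr rfl fun κ _ => ?_
    rw [J2Sp_tauPar hsum hP κ hK, J1Sp_tauPar hsum hP κ K (by omega),
      J1Sp_tauPar hsum hP κ (K + 1) (by push_cast; omega)]
    ring
  · refine Finset.sum_congr rfl fun l _ => ?_
    rw [J2Tp_tauPar hsum hP l hK, J1Tp_tauPar hsum hP l (mm := k + 1) K (by omega),
      J1Tp_tauPar hsum hP l (mm := k + 2) (K + 1) (by push_cast; omega), hwitt]
    ring

theorem dCp_tauPar (hP : P.FiniteTimes) (hc : StrictMono P.c) (i : Fin (2 * r)) :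
    dCp i (tauPar m n) P = ∑ R, Matrix.detRowAlternating (Function.update
      (blockRows (tauRow hsum P) fun R => (R.2 : ℕ)) R fun R' =>
        edgeSign i * (P.c i ^ ((R.2 : ℕ) + ((rowColEquiv hsum R').2 : ℕ))
          * Real.exp (blockExponent P R.1 (rowColEquiv hsum R').1 (P.c i)))) := by
  rw [tauPar_eq_kernelDet hsum]
  have key := hasDerivAt_detRowAlternating (x := P.c i)
    (M := fun y => blockRows (tauRow hsum { P with c := Function.update P.c i y })
      fun R => (R.2 : ℕ))
    (fun R R' => hasDerivAt_blockMoment_c hP hc i R.1 (rowColEquiv hsum R').1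
      ((R.2 : ℕ) + ((rowColEquiv hsum R').2 : ℕ)))
  simp only [Function.update_eq_self] at key
  exact key.deriv

theorem sum_pow_mul_dCp_tauPar (hP : P.FiniteTimes) (hc : StrictMono P.c) (K : ℕ) :
    ∑ i, P.c i ^ K * dCp i (tauPar m n) P
      = ∑ κ, (wittSum Matrix.detRowAlternating (tauRow hsum P) κ K K
          + P.a κ * raiseSum Matrix.detRowAlternating (tauRow hsum P) κ K
          + (-(1 - 2 * P.al κ)) * raiseSum Matrix.detRowAlternating (tauRow hsum P) κ (K + 1)
          + ∑ ν ∈ timeSupport (hP.1 κ), (ν : ℝ) * -P.s κ ν *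
            raiseSum Matrix.detRowAlternating (tauRow hsum P) κ (K + ν - 1))
        + ∑ l, (wittSum Matrix.detRowAlternating (tauCol hsum P) l 0 K
          + P.b l * raiseSum Matrix.detRowAlternating (tauCol hsum P) l K
          + 2 * P.be l * raiseSum Matrix.detRowAlternating (tauCol hsum P) l (K + 1)
          + ∑ ν ∈ timeSupport (hP.2 l), (ν : ℝ) * P.t l ν *
            raiseSum Matrix.detRowAlternating (tauCol hsum P) l (K + ν - 1)) := by
  set σ := rowColEquiv hsum with hσ
  set Y : (Σ κ : Fin q, Fin (m κ)) → (Σ κ : Fin q, Fin (m κ)) → ℝ := fun R =>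
    ((R.2 : ℝ) + K) • tauRow hsum P R.1 (R.2 + K - 1) + P.a R.1 • tauRow hsum P R.1 (R.2 + K)
      + (-(1 - 2 * P.al R.1)) • tauRow hsum P R.1 (R.2 + (K + 1))
      + ∑ ν ∈ timeSupport (hP.1 R.1),
        ((ν : ℝ) * -P.s R.1 ν) • tauRow hsum P R.1 (R.2 + (K + ν - 1)) with hY
  set Z : (Σ l : Fin p, Fin (n l)) → (Σ l : Fin p, Fin (n l)) → ℝ := fun C =>
    ((C.2 : ℝ) + 0) • tauCol hsum P C.1 (C.2 + K - 1) + P.b C.1 • tauCol hsum P C.1 (C.2 + K)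
      + (2 * P.be C.1) • tauCol hsum P C.1 (C.2 + (K + 1))
      + ∑ ν ∈ timeSupport (hP.2 C.1),
        ((ν : ℝ) * P.t C.1 ν) • tauCol hsum P C.1 (C.2 + (K + ν - 1)) with hZ
  have hedge : ∀ R R', ∑ i, P.c i ^ K * (edgeSign i * (P.c i ^ ((R.2 : ℕ) + ((σ R').2 : ℕ))
      * Real.exp (blockExponent P R.1 (σ R').1 (P.c i)))) = Y R R' + Z (σ R') (σ R) := by
    intro R R'
    rw [sum_edge_pow_mul_moment hP hc R.1 (σ R').1 R.2 (σ R').2 K]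
    have hR : ((σ.symm (σ R)).2 : ℕ) = R.2 := by rw [Equiv.symm_apply_apply]
    simp [hY, hZ, tauRow, tauCol, kernelRow, ← hσ, hR]
  have hrow := sum_map_update_blockRows Matrix.detRowAlternating (tauRow hsum P) K P.a
    (fun κ => -(1 - 2 * P.al κ)) (fun κ ν => -P.s κ ν) (fun κ => timeSupport (hP.1 κ)) K
  have hcol := sum_map_update_blockRows Matrix.detRowAlternating (tauCol hsum P) 0 P.b
    (fun l => 2 * P.be l) P.t (fun l => timeSupport (hP.2 l)) K
  rw [← hrow, ← hcol]
  have hswap := sum_det_update_eq_sum_det_update_symm σ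
    (blockRows (tauRow hsum P) fun R => (R.2 : ℕ)) (fun R R' => Z (σ R') (σ R))
  have htr : (fun C C' => blockRows (tauRow hsum P) (fun R => (R.2 : ℕ)) (σ.symm C') (σ.symm C))
      = blockRows (tauCol hsum P) fun C => (C.2 : ℕ) := by
    ext C C'
    have hC : ((rowColEquiv hsum (σ.symm C)).2 : ℕ) = C.2 := by rw [← hσ, Equiv.apply_symm_apply]
    have hC' : (((rowColEquiv hsum).symm C').2 : ℕ) = (σ.symm C').2 := rfl
    simp [blockRows, tauRow, tauCol, kernelRow, ← hσ, hC, hC', add_comm]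
  rw [htr] at hswap
  simp only [Equiv.apply_symm_apply] at hswap
  calc ∑ i, P.c i ^ K * dCp i (tauPar m n) P
      = ∑ R, Matrix.detRowAlternating (Function.update
          (blockRows (tauRow hsum P) fun R => (R.2 : ℕ)) R
          (Y R + fun R' => Z (σ R') (σ R))) := by
        simp only [dCp_tauPar hsum hP hc, Finset.mul_sum]
        rw [Finset.sum_comm]
        refine Finset.sum_congr rfl fun R _ => ?_
        have hvec : (Y R + fun R' => Z (σ R') (σ R)) = ∑ i, P.c i ^ K • fun R' =>
            edgeSign i * (P.c i ^ ((R.2 : ℕ) + ((σ R').2 : ℕ))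
              * Real.exp (blockExponent P R.1 (σ R').1 (P.c i))) := by
          ext R'
          simp only [Finset.sum_apply, Pi.smul_apply, smul_eq_mul, Pi.add_apply]
          exact (hedge R R').symm
        rw [hvec, AlternatingMap.map_update_sum]
        simp only [AlternatingMap.map_update_smul, smul_eq_mul]
        rfl
    _ = ∑ R, Matrix.detRowAlternating (Function.update
          (blockRows (tauRow hsum P) fun R => (R.2 : ℕ)) R (Y R))
        + ∑ C, Matrix.detRowAlternating (Function.update
          (blockRows (tauCol hsum P) fun C => (C.2 : ℕ)) C (Z C)) := by
        simp only [AlternatingMap.map_update_add, Finset.sum_add_distrib]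
        rw [hswap]

end Tau

/-- **Theorem 4.3** (Virasoro constraints): for every `k ≥ −1` the tau function satisfies
`𝔅_k τ^E_{m,n} = 𝕍_k^{m,n} τ^E_{m,n}` with `𝔅_k = Σ_{i=1}^{2r} c_i^{k+1} ∂/∂c_i`, as an
identity of functions of all the parameters. -/
theorem virasoro_constraints (q p r : ℕ) (hq : 1 ≤ q) (hp : 1 ≤ p)
    (m : Fin q → ℕ) (n : Fin p → ℕ) (hm1 : ∀ i, 1 ≤ m i) (hn1 : ∀ l, 1 ≤ n l)
    (hsum : ∑ l, n l = ∑ i, m i)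
    (k : ℤ) (hk : -1 ≤ k)
    (P : Par q p r) (hc : StrictMono P.c)
    (hs : ∀ i, (Function.support (P.s i)).Finite)
    (ht : ∀ i, (Function.support (P.t i)).Finite) :
    (∑ i : Fin (2 * r), P.c i ^ (k + 1).toNat * dCp i (tauPar m n) P)
      = Vpar m n k (tauPar m n) P := by
  have hP : P.FiniteTimes := ⟨hs, ht⟩
  rw [sum_pow_mul_dCp_tauPar hsum hP hc, Vpar_tauPar hsum hP (K := (k + 1).toNat) (by omega)]
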